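/- Let n = 1204 and p = 1/2, and let G_n be the graph on vertices {a, v₁, …, v_n} with edges {a, v_i} for 1 ≤ i ≤ n and {v_i, v_{i+1}} for 1 ≤ i ≤ n−1, with b := v₁ and c := v_n. Then the connection probabilities of Bernoulli bond percolation on G_n with deletion parameter p satisfy 400·p_{a|bc} ≤ p_{abc}·p_{a|b|c} − p_{ab|c}², where p_{abc} := P_p[a ↔ b ↔ c], p_{a|bc} := P_p[a ↮ b, b ↔ c], p_{ab|c} := P_p[a ↔ b, b ↮ c], and p_{a|b|c} := P_p[a ↮ b, b ↮ c, c ↮ a]. -/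

import Mathlib

open Classical SimpleGraph

noncomputable section

/-- The graph `G_n` on vertex set `{a} ∪ {v₁, …, vₙ}` (with `a = none` and
`vₖ = some ⟨k-1⟩`), with edges `{a, vᵢ}` for `1 ≤ i ≤ n` and `{vᵢ, vᵢ₊₁}`
for `1 ≤ i ≤ n-1`. -/
def gadget (n : ℕ) : SimpleGraph (Option (Fin n)) :=
  SimpleGraph.fromRel (fun x y =>
    x = none ∨ ∃ i j : Fin n, x = some i ∧ y = some j ∧ (j : ℕ) = (i : ℕ) + 1)

/-- The probability, under Bernoulli bond percolation on `G_n` in which each edge is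
independently closed (deleted) with probability `p` and open (retained) with
probability `1 - p`, of the event `A` of the open subgraph. -/
def gadgetProb (n : ℕ) (p : ℝ) (A : SimpleGraph (Option (Fin n)) → Prop) : ℝ :=
  ∑ S ∈ (gadget n).edgeFinset.powerset,
    (1 - p) ^ S.card * p ^ ((gadget n).edgeFinset.card - S.card) *
      (if A (SimpleGraph.fromEdgeSet ↑S) then 1 else 0)

def gQ (T : Finset ℕ) (j k : ℕ) : Prop := ∀ i, j ≤ i → i < k → 2 * i + 1 ∈ T
def gB (k : ℕ) (T : Finset ℕ) : Prop := ∃ j, j ≤ k ∧ 2 * j ∈ T ∧ gQ T 0 j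
def gC (k : ℕ) (T : Finset ℕ) : Prop := ∃ j, j ≤ k ∧ 2 * j ∈ T ∧ gQ T j k

theorem gQ_succ (T : Finset ℕ) (j k : ℕ) (h : j ≤ k) :
    gQ T j (k + 1) ↔ gQ T j k ∧ 2 * k + 1 ∈ T := by
  constructor
  · intro H
    exact ⟨fun i h1 h2 => H i h1 (by omega), H k h (by omega)⟩
  · rintro ⟨H, h'⟩ i h1 h2
    rcases Nat.lt_succ_iff_lt_or_eq.mp h2 with h3 | h3
    · exact H i h1 h3
    · subst h3; exact h'

theorem gB_succ (T : Finset ℕ) (k : ℕ) :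
    gB (k + 1) T ↔ gB k T ∨ (gQ T 0 k ∧ 2 * k + 1 ∈ T ∧ 2 * k + 2 ∈ T) := by
  constructor
  · rintro ⟨j, h1, h2, h3⟩
    rcases Nat.le_succ_iff.mp h1 with h4 | h4
    · exact Or.inl ⟨j, h4, h2, h3⟩
    · subst h4
      have := (gQ_succ T 0 k (by omega)).mp h3
      exact Or.inr ⟨this.1, this.2, h2⟩
  · rintro (⟨j, h1, h2, h3⟩ | ⟨h1, h2, h3⟩)
    · exact ⟨j, by omega, h2, h3⟩
    · exact ⟨k + 1, le_rfl, h3, (gQ_succ T 0 k (by omega)).mpr ⟨h1, h2⟩⟩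

theorem gC_succ (T : Finset ℕ) (k : ℕ) :
    gC (k + 1) T ↔ 2 * k + 2 ∈ T ∨ (2 * k + 1 ∈ T ∧ gC k T) := by
  constructor
  · rintro ⟨j, h1, h2, h3⟩
    rcases Nat.le_succ_iff.mp h1 with h4 | h4
    · have := (gQ_succ T j k h4).mp h3
      exact Or.inr ⟨this.2, j, h4, h2, this.1⟩
    · subst h4
      exact Or.inl h2
  · rintro (h | ⟨h, j, h1, h2, h3⟩)
    · exact ⟨k + 1, le_rfl, h, fun i _ _ => by omega⟩
    · exact ⟨j, by omega, h2, (gQ_succ T j k h1).mpr ⟨h3, h⟩⟩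

theorem gQ_congr {T T' : Finset ℕ} {j k N : ℕ} (h : ∀ e, e < N → (e ∈ T ↔ e ∈ T'))
    (hk : 2 * k ≤ N) : gQ T j k ↔ gQ T' j k := by
  unfold gQ
  refine forall_congr' fun i => imp_congr_right fun _ => ?_
  refine forall_congr' fun h2 => h _ (by omega)

theorem gB_congr {T T' : Finset ℕ} {k : ℕ} (h : ∀ e, e < 2 * k + 1 → (e ∈ T ↔ e ∈ T')) :
    gB k T ↔ gB k T' := by
  unfold gB
  refine exists_congr fun j => and_congr_right fun hj => ?_
  exact and_congr (h _ (by omega)) (gQ_congr h (by omega))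

theorem gC_congr {T T' : Finset ℕ} {k : ℕ} (h : ∀ e, e < 2 * k + 1 → (e ∈ T ↔ e ∈ T')) :
    gC k T ↔ gC k T' := by
  unfold gC
  refine exists_congr fun j => and_congr_right fun hj => ?_
  exact and_congr (h _ (by omega)) (gQ_congr h (by omega))

theorem gBC (T : Finset ℕ) (k : ℕ) (h : gQ T 0 k) : gB k T ↔ gC k T := by
  constructor
  · rintro ⟨j, h1, h2, h3⟩
    exact ⟨j, h1, h2, fun i _ hi => h i (by omega) hi⟩
  · rintro ⟨j, h1, h2, h3⟩
    exact ⟨j, h1, h2, fun i _ hi => h i (by omega) (by omega)⟩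

/-- Uniform average over configurations. -/
def gE (k : ℕ) (F : Prop → Prop → Prop → ℝ) : ℝ :=
  (1 / 2) ^ (2 * k + 1) *
    ∑ T ∈ (Finset.range (2 * k + 1)).powerset, F (gB k T) (gC k T) (gQ T 0 k)

theorem gE_succ (k : ℕ) (F : Prop → Prop → Prop → ℝ) :
    gE (k + 1) F = gE k (fun B C P => (1 / 4) *
      (F B False False + F B C P + F B True False + F (B ∨ P) True P)) := by
  unfold gE
  rw [show 2 * (k + 1) + 1 = 2 * k + 1 + 1 + 1 by ring, Finset.range_add_one,
    Finset.sum_powerset_insert (by simp), Finset.range_add_one,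
    Finset.sum_powerset_insert (by simp), Finset.sum_powerset_insert (by simp),
    ← Finset.sum_add_distrib, ← Finset.sum_add_distrib, ← Finset.sum_add_distrib,
    pow_succ, pow_succ, mul_assoc, mul_assoc]
  congr 1
  rw [Finset.mul_sum, Finset.mul_sum]
  refine Finset.sum_congr rfl fun T hT => ?_
  rw [Finset.mem_powerset] at hT
  have n1 : 2 * k + 1 ∉ T := fun h => by simpa using hT h
  have n2 : 2 * k + 1 + 1 ∉ T := fun h => by have := hT h; simp at this
  have c1 : ∀ e, e < 2 * k + 1 → (e ∈ insert (2 * k + 1) T ↔ e ∈ T) := by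
    intro e he; simp only [Finset.mem_insert]; constructor
    · rintro (h | h)
      · omega
      · exact h
    · exact Or.inr
  have c2 : ∀ e, e < 2 * k + 1 → (e ∈ insert (2 * k + 1 + 1) T ↔ e ∈ T) := by
    intro e he; simp only [Finset.mem_insert]; constructor
    · rintro (h | h)
      · omega
      · exact h
    · exact Or.inr
  have c3 : ∀ e, e < 2 * k + 1 →
      (e ∈ insert (2 * k + 1 + 1) (insert (2 * k + 1) T) ↔ e ∈ T) := by
    intro e he; simp only [Finset.mem_insert]; constructor
    · rintro (h | h | h)
      · omega
      · omega
      · exact h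
    · exact fun h => Or.inr (Or.inr h)
  simp only [gB_succ, gC_succ, gQ_succ _ 0 k (Nat.zero_le _), gB_congr c1, gB_congr c2,
    gB_congr c3, gC_congr c1, gC_congr c2, gC_congr c3,
    gQ_congr c1 (j := 0) (k := k) (by omega), gQ_congr c2 (j := 0) (k := k) (by omega),
    gQ_congr c3 (j := 0) (k := k) (by omega)]
  simp [n1, n2]
  ring

theorem gE_congr (k : ℕ) (F F' : Prop → Prop → Prop → ℝ)
    (h : ∀ B C P : Prop, (P → (B ↔ C)) → F B C P = F' B C P) : gE k F = gE k F' := by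
  unfold gE
  congr 1
  exact Finset.sum_congr rfl fun T _ => h _ _ _ (gBC T k)

def iS (B C _P : Prop) : ℝ := if B ∧ C then 1 else 0
def iT (B C _P : Prop) : ℝ := if B ∧ ¬ C then 1 else 0
def iU (B C _P : Prop) : ℝ := if ¬ B ∧ C then 1 else 0
def iW (B C P : Prop) : ℝ := if ¬ B ∧ ¬ C ∧ ¬ P then 1 else 0
def iZ (B _C P : Prop) : ℝ := if ¬ B ∧ P then 1 else 0

theorem gE_lin (k : ℕ) (a b c d e : ℝ) :
    gE k (fun B C P => a * iS B C P + b * iT B C P + c * iU B C P + d * iW B C P + e * iZ B C P)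
      = a * gE k iS + b * gE k iT + c * gE k iU + d * gE k iW + e * gE k iZ := by
  unfold gE
  simp only [Finset.sum_add_distrib, ← Finset.mul_sum]
  ring

theorem step_gen (k : ℕ) (F : Prop → Prop → Prop → ℝ) (a b c d e : ℝ)
    (h : ∀ B C P : Prop, (P → (B ↔ C)) → (1 / 4) *
      (F B False False + F B C P + F B True False + F (B ∨ P) True P) =
      a * iS B C P + b * iT B C P + c * iU B C P + d * iW B C P + e * iZ B C P) :
    gE (k + 1) F = a * gE k iS + b * gE k iT + c * gE k iU + d * gE k iW + e * gE k iZ := by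
  rw [gE_succ, ← gE_lin]
  exact gE_congr _ _ _ h

theorem step_S (k : ℕ) : gE (k + 1) iS =
    3 / 4 * gE k iS + 1 / 2 * gE k iT + 0 * gE k iU + 0 * gE k iW + 1 / 4 * gE k iZ := by
  apply step_gen
  intro B C P h
  by_cases B <;> by_cases C <;> by_cases P <;> simp_all [iS, iT, iU, iW, iZ] <;> norm_num

theorem step_T (k : ℕ) : gE (k + 1) iT =
    1 / 4 * gE k iS + 1 / 2 * gE k iT + 0 * gE k iU + 0 * gE k iW + 0 * gE k iZ := by
  apply step_gen
  intro B C P h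
  by_cases B <;> by_cases C <;> by_cases P <;> simp_all [iS, iT, iU, iW, iZ] <;> norm_num

theorem step_U (k : ℕ) : gE (k + 1) iU =
    0 * gE k iS + 0 * gE k iT + 3 / 4 * gE k iU + 1 / 2 * gE k iW + 1 / 4 * gE k iZ := by
  apply step_gen
  intro B C P h
  by_cases B <;> by_cases C <;> by_cases P <;> simp_all [iS, iT, iU, iW, iZ] <;> norm_num

theorem step_W (k : ℕ) : gE (k + 1) iW =
    0 * gE k iS + 0 * gE k iT + 1 / 4 * gE k iU + 1 / 2 * gE k iW + 1 / 4 * gE k iZ := by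
  apply step_gen
  intro B C P h
  by_cases B <;> by_cases C <;> by_cases P <;> simp_all [iS, iT, iU, iW, iZ] <;> norm_num

theorem step_Z (k : ℕ) : gE (k + 1) iZ =
    0 * gE k iS + 0 * gE k iT + 0 * gE k iU + 0 * gE k iW + 1 / 4 * gE k iZ := by
  apply step_gen
  intro B C P h
  by_cases B <;> by_cases C <;> by_cases P <;> simp_all [iS, iT, iU, iW, iZ] <;> norm_num

theorem base_gen (F : Prop → Prop → Prop → ℝ) :
    gE 0 F = 1 / 2 * (F False False True + F True True True) := by
  have h : (Finset.range (2 * 0 + 1)).powerset = {∅, {0}} := by decide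
  unfold gE
  rw [h, Finset.sum_pair (by decide)]
  simp [gB, gC, gQ]

/-- All facts about the five probabilities. -/
theorem main_inv (k : ℕ) :
    0 < gE k iZ ∧ gE k iZ ≤ 1 / 2 ∧
    gE k iS + gE k iT = 2 / 3 - gE k iZ / 3 ∧
    gE k iU = gE k iT ∧
    gE k iS + gE k iT + gE k iU + gE k iW + gE k iZ = 1 ∧
    gE k iT ≤ 2 / 9 ∧
    ((k : ℝ) / 3 - 1 / 6 + gE k iZ / 3) * gE k iZ ≤
      gE k iS * gE k iW - gE k iT * gE k iU := by
  induction k with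
  | zero =>
    simp only [base_gen, iS, iT, iU, iW, iZ]
    norm_num
  | succ k ih =>
    simp only [step_S, step_T, step_U, step_W, step_Z]
    obtain ⟨h1, h2, h3, h4, h5, h6, h7⟩ := ih
    generalize gE k iS = s at *
    generalize gE k iT = t at *
    generalize gE k iU = u at *
    generalize gE k iW = w at *
    generalize gE k iZ = z at *
    subst h4
    have hs : s = 2 / 3 - z / 3 - u := by linarith
    have hw : w = 1 - z - 2 * u - s := by linarith
    refine ⟨by linarith, by linarith, by linarith, by linarith, by linarith, by linarith, ?_⟩
    push_cast
    subst hw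
    subst hs
    nlinarith [mul_nonneg h1.le (sub_nonneg.mpr h6)]

theorem reach_closed {V : Type*} (G : SimpleGraph V) (R : V → Prop)
    (h : ∀ x y, R x → G.Adj x y → R y) {x y : V} (hx : R x) (hr : G.Reachable x y) : R y := by
  obtain ⟨w⟩ := hr
  induction w with
  | nil => exact hx
  | cons hadj _ ih => exact ih (h _ _ hx hadj)

theorem reach_path {m : ℕ} (T : Finset ℕ) (G : SimpleGraph (Option (Fin (m + 1))))
    (h2 : ∀ i j : Fin (m + 1), G.Adj (some i) (some j) ↔
      ((j : ℕ) = i + 1 ∧ 2 * (i : ℕ) + 1 ∈ T) ∨ ((i : ℕ) = j + 1 ∧ 2 * (j : ℕ) + 1 ∈ T))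
    (j k : ℕ) (hk : k < m + 1) (hjk : j ≤ k) (hQ : gQ T j k) :
    G.Reachable (some ⟨j, by omega⟩) (some ⟨k, hk⟩) := by
  induction k with
  | zero => obtain rfl : j = 0 := by omega
            exact Reachable.refl _
  | succ k ih =>
    rcases Nat.le_succ_iff.mp hjk with h | h
    · have hq := (gQ_succ T j k h).mp hQ
      refine (ih (by omega) h hq.1).trans (Adj.reachable ?_)
      rw [h2]
      exact Or.inl ⟨rfl, hq.2⟩
    · subst h
      exact Reachable.refl _

theorem reach_none {m : ℕ} (T : Finset ℕ) (G : SimpleGraph (Option (Fin (m + 1))))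
    (h1 : ∀ i : Fin (m + 1), G.Adj none (some i) ↔ 2 * (i : ℕ) ∈ T)
    (h2 : ∀ i j : Fin (m + 1), G.Adj (some i) (some j) ↔
      ((j : ℕ) = i + 1 ∧ 2 * (i : ℕ) + 1 ∈ T) ∨ ((i : ℕ) = j + 1 ∧ 2 * (j : ℕ) + 1 ∈ T))
    (x : Fin (m + 1)) : G.Reachable none (some x) ↔
    ∃ j, j ≤ m ∧ 2 * j ∈ T ∧ gQ T j x ∧ gQ T x j := by
  constructor
  · intro h
    refine reach_closed G (fun y => ∀ x : Fin (m + 1), y = some x →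
      ∃ j, j ≤ m ∧ 2 * j ∈ T ∧ gQ T j x ∧ gQ T x j) ?_ (x := none) (by simp) h x rfl
    rintro x y hx hadj z rfl
    rcases x with _ | x
    · exact ⟨z, by omega, (h1 z).mp hadj, fun i _ _ => by omega, fun i _ _ => by omega⟩
    · obtain ⟨j, a1, a2, a3, a4⟩ := hx x rfl
      refine ⟨j, a1, a2, ?_, ?_⟩
      · intro i b1 b2
        rcases (h2 x z).mp hadj with ⟨c1, c2⟩ | ⟨c1, c2⟩
        · by_cases hi : i = x
          · rw [hi]; exact c2
          · exact a3 i b1 (by omega)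
        · exact a3 i b1 (by omega)
      · intro i b1 b2
        rcases (h2 x z).mp hadj with ⟨c1, c2⟩ | ⟨c1, c2⟩
        · exact a4 i (by omega) b2
        · by_cases hi : i = z
          · rw [hi]; exact c2
          · exact a4 i (by omega) b2
  · rintro ⟨j, a1, a2, a3, a4⟩
    have hj : G.Reachable none (some ⟨j, by omega⟩) :=
      Adj.reachable ((h1 ⟨j, by omega⟩).mpr a2)
    refine hj.trans ?_
    rcases le_total j x with h | h
    · exact reach_path T G h2 j x x.2 h a3
    · exact (reach_path T G h2 x j (by omega) h a4).symm

theorem reach_B {m : ℕ} (T : Finset ℕ) (G : SimpleGraph (Option (Fin (m + 1))))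
    (h1 : ∀ i : Fin (m + 1), G.Adj none (some i) ↔ 2 * (i : ℕ) ∈ T)
    (h2 : ∀ i j : Fin (m + 1), G.Adj (some i) (some j) ↔
      ((j : ℕ) = i + 1 ∧ 2 * (i : ℕ) + 1 ∈ T) ∨ ((i : ℕ) = j + 1 ∧ 2 * (j : ℕ) + 1 ∈ T))
    : G.Reachable none (some ⟨0, by omega⟩) ↔ gB m T := by
  rw [reach_none T G h1 h2]
  refine exists_congr fun j => and_congr_right fun _ => and_congr_right fun _ => ?_
  exact ⟨fun h => h.2, fun h => ⟨fun i _ hi => by simp at hi, h⟩⟩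

theorem reach_C {m : ℕ} (T : Finset ℕ) (G : SimpleGraph (Option (Fin (m + 1))))
    (h1 : ∀ i : Fin (m + 1), G.Adj none (some i) ↔ 2 * (i : ℕ) ∈ T)
    (h2 : ∀ i j : Fin (m + 1), G.Adj (some i) (some j) ↔
      ((j : ℕ) = i + 1 ∧ 2 * (i : ℕ) + 1 ∈ T) ∨ ((i : ℕ) = j + 1 ∧ 2 * (j : ℕ) + 1 ∈ T))
    : G.Reachable none (some ⟨m, by omega⟩) ↔ gC m T := by
  rw [reach_none T G h1 h2]
  refine exists_congr fun j => and_congr_right fun hj => and_congr_right fun _ => ?_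
  exact ⟨fun h => h.1, fun h => ⟨h, fun i hi _ => by simp at hi; omega⟩⟩

theorem reach_BC {m : ℕ} (T : Finset ℕ) (G : SimpleGraph (Option (Fin (m + 1))))
    (h1 : ∀ i : Fin (m + 1), G.Adj none (some i) ↔ 2 * (i : ℕ) ∈ T)
    (h2 : ∀ i j : Fin (m + 1), G.Adj (some i) (some j) ↔
      ((j : ℕ) = i + 1 ∧ 2 * (i : ℕ) + 1 ∈ T) ∨ ((i : ℕ) = j + 1 ∧ 2 * (j : ℕ) + 1 ∈ T))
    : G.Reachable (some ⟨0, by omega⟩) (some ⟨m, by omega⟩) ↔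
    (gB m T ∧ gC m T) ∨ gQ T 0 m := by
  constructor
  · intro h
    by_cases hB : gB m T
    · left
      refine ⟨hB, ?_⟩
      rw [← reach_C T G h1 h2]
      exact ((reach_B T G h1 h2).mpr hB).trans h
    · right
      have key : ∃ x : Fin (m + 1), some (⟨m, by omega⟩ : Fin (m + 1)) = some x ∧ gQ T 0 x := by
        refine reach_closed G (fun y => ∃ x : Fin (m + 1), y = some x ∧ gQ T 0 x) ?_
          (x := some ⟨0, by omega⟩) ⟨_, rfl, fun i _ hi => by simp at hi⟩ h
        rintro _ y ⟨x, rfl, hx⟩ hadj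
        rcases y with _ | y
        · exact absurd ⟨x, by omega, (h1 x).mp hadj.symm, hx⟩ hB
        · refine ⟨y, rfl, ?_⟩
          rcases (h2 x y).mp hadj with ⟨c1, c2⟩ | ⟨c1, c2⟩
          · rw [c1, gQ_succ _ _ _ (Nat.zero_le _)]
            exact ⟨hx, c2⟩
          · exact fun i _ hi => hx i (by omega) (by omega)
      obtain ⟨x, hx, hq⟩ := key
      obtain rfl := Option.some.inj hx
      exact hq
  · rintro (⟨hB, hC⟩ | h)
    · exact ((reach_B T G h1 h2).mpr hB).symm.trans ((reach_C T G h1 h2).mpr hC)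
    · exact reach_path T G h2 0 m (by omega) (by omega) h


/-- Edge coding. -/
def gphi (m e : ℕ) : Sym2 (Option (Fin (m + 1))) :=
  if e % 2 = 0 then s(none, some (Fin.ofNat (m + 1) (e / 2)))
  else s(some (Fin.ofNat (m + 1) (e / 2)), some (Fin.ofNat (m + 1) (e / 2 + 1)))

theorem gphi_spoke (m e : ℕ) (he : e < 2 * m + 1) (i : Fin (m + 1)) :
    gphi m e = s(none, some i) ↔ e = 2 * i := by
  have h1 : e / 2 % (m + 1) = e / 2 := Nat.mod_eq_of_lt (by omega)
  unfold gphi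
  split_ifs with h
  · simp [Fin.ext_iff, h1]; omega
  · simp; omega

theorem gphi_path (m e : ℕ) (he : e < 2 * m + 1) (i j : Fin (m + 1)) :
    gphi m e = s(some i, some j) ↔
      ((j : ℕ) = i + 1 ∧ e = 2 * i + 1) ∨ ((i : ℕ) = j + 1 ∧ e = 2 * j + 1) := by
  have h1 : e / 2 % (m + 1) = e / 2 := Nat.mod_eq_of_lt (by omega)
  unfold gphi
  split_ifs with h
  · simp; omega
  · have h2 : (e / 2 + 1) % (m + 1) = e / 2 + 1 := Nat.mod_eq_of_lt (by omega)
    simp [Fin.ext_iff, h1, h2]; omega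

theorem gphi_none (m e : ℕ) : gphi m e ≠ s(none, none) := by
  unfold gphi
  split_ifs <;> simp

theorem gphi_injOn (m : ℕ) : Set.InjOn (gphi m) (Finset.range (2 * m + 1) : Set ℕ) := by
  intro e he e' he' h
  simp only [Finset.coe_range, Set.mem_Iio] at he he'
  by_cases hp : e % 2 = 0
  · have := (gphi_spoke m e he ⟨e / 2, by omega⟩).mpr (by simp; omega)
    rw [h, gphi_spoke m e' he'] at this
    simp at this; omega
  · have := (gphi_path m e he ⟨e / 2, by omega⟩ ⟨e / 2 + 1, by omega⟩).mpr (by simp; omega)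
    rw [h, gphi_path m e' he'] at this
    simp at this; omega

theorem gphi_edge (m : ℕ) :
    (gadget (m + 1)).edgeFinset = (Finset.range (2 * m + 1)).image (gphi m) := by
  ext x
  rw [mem_edgeFinset, Finset.mem_image]
  induction x with | _ x y
  rw [mem_edgeSet]
  simp only [Finset.mem_range, gadget, fromRel_adj]
  rcases x with _ | x <;> rcases y with _ | y
  · simp [gphi_none]
  · constructor
    · intro _
      exact ⟨2 * y, by omega, (gphi_spoke m _ (by omega) y).mpr rfl⟩
    · intro _; simp
  · constructor
    · intro _
      exact ⟨2 * x, by omega, by rw [Sym2.eq_swap]; exact (gphi_spoke m _ (by omega) x).mpr rfl⟩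
    · intro _; simp
  · constructor
    · rintro ⟨_, (h | h) | (h | h)⟩
      · simp at h
      · obtain ⟨i, j, hi, hj, h⟩ := h
        cases hi; cases hj
        exact ⟨2 * x + 1, by omega, (gphi_path m _ (by omega) _ _).mpr (Or.inl ⟨h, rfl⟩)⟩
      · simp at h
      · obtain ⟨i, j, hi, hj, h⟩ := h
        cases hi; cases hj
        exact ⟨2 * y + 1, by omega, (gphi_path m _ (by omega) _ _).mpr (Or.inr ⟨h, rfl⟩)⟩
    · rintro ⟨e, he, h⟩
      rw [gphi_path m e he] at h
      refine ⟨?_, ?_⟩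
      · intro hxy
        cases hxy
        omega
      · rcases h with h | h
        · exact Or.inl (Or.inr ⟨x, y, rfl, rfl, h.1⟩)
        · exact Or.inr (Or.inr ⟨y, x, rfl, rfl, h.1⟩)

theorem prob_eq (m : ℕ) (A : SimpleGraph (Option (Fin (m + 1))) → Prop) :
    gadgetProb (m + 1) (1 / 2) A = (1 / 2) ^ (2 * m + 1) *
      ∑ T ∈ (Finset.range (2 * m + 1)).powerset,
        (if A (fromEdgeSet (↑(T.image (gphi m)) : Set (Sym2 (Option (Fin (m + 1)))))) then
          (1 : ℝ) else 0) := by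
  unfold gadgetProb
  rw [Finset.mul_sum]
  have hcard : (gadget (m + 1)).edgeFinset.card = 2 * m + 1 := by
    rw [gphi_edge, Finset.card_image_of_injOn (gphi_injOn m), Finset.card_range]
  symm
  refine Finset.sum_bij (fun T _ => T.image (gphi m)) ?_ ?_ ?_ ?_
  · intro T hT
    rw [Finset.mem_powerset] at hT ⊢
    rw [gphi_edge]
    exact Finset.image_subset_image hT
  · intro T hT T' hT' h
    rw [Finset.mem_powerset] at hT hT'
    have h' := congrArg (fun s : Finset _ => (s : Set (Sym2 (Option (Fin (m + 1)))))) h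
    simp only [Finset.coe_image] at h'
    have := ((gphi_injOn m).image_eq_image_iff (Finset.coe_subset.mpr hT)
      (Finset.coe_subset.mpr hT')).mp h'
    exact_mod_cast this
  · intro S hS
    rw [Finset.mem_powerset, gphi_edge] at hS
    obtain ⟨T, hT, rfl⟩ := Finset.subset_image_iff.mp hS
    exact ⟨T, Finset.mem_powerset.mpr (by exact_mod_cast hT), rfl⟩
  · intro T hT
    rw [Finset.mem_powerset] at hT
    have hc : (T.image (gphi m)).card ≤ 2 * m + 1 := by
      have := Finset.card_le_card hT
      rw [Finset.card_range] at this
      exact Finset.card_image_le.trans this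
    rw [hcard, show (1 - 1 / 2 : ℝ) = 1 / 2 by norm_num, ← pow_add, Nat.add_sub_of_le hc]

theorem prob_gE (m : ℕ) (A : SimpleGraph (Option (Fin (m + 1))) → Prop)
    (F : Prop → Prop → Prop → ℝ)
    (h : ∀ (G : SimpleGraph (Option (Fin (m + 1)))) (T : Finset ℕ),
      (gQ T 0 m → (gB m T ↔ gC m T)) →
      (G.Reachable none (some ⟨0, by omega⟩) ↔ gB m T) →
      (G.Reachable none (some ⟨m, by omega⟩) ↔ gC m T) →
      (G.Reachable (some ⟨0, by omega⟩) (some ⟨m, by omega⟩) ↔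
        (gB m T ∧ gC m T) ∨ gQ T 0 m) →
      (if A G then (1 : ℝ) else 0) = F (gB m T) (gC m T) (gQ T 0 m)) :
    gadgetProb (m + 1) (1 / 2) A = gE m F := by
  rw [prob_eq, gE]
  congr 1
  refine Finset.sum_congr rfl fun T hT => ?_
  rw [Finset.mem_powerset] at hT
  have hlt : ∀ e ∈ T, e < 2 * m + 1 := fun e he => Finset.mem_range.mp (hT he)
  have h1 : ∀ i : Fin (m + 1),
      (fromEdgeSet (↑(T.image (gphi m)) : Set (Sym2 (Option (Fin (m + 1)))))).Adj none (some i) ↔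
        2 * (i : ℕ) ∈ T := by
    intro i
    rw [fromEdgeSet_adj, Finset.mem_coe, Finset.mem_image]
    constructor
    · rintro ⟨⟨e, he, h⟩, _⟩
      rw [gphi_spoke m e (hlt e he)] at h
      exact h ▸ he
    · intro h
      exact ⟨⟨_, h, (gphi_spoke m _ (hlt _ h) i).mpr rfl⟩, by simp⟩
  have h2 : ∀ i j : Fin (m + 1),
      (fromEdgeSet (↑(T.image (gphi m)) : Set (Sym2 (Option (Fin (m + 1)))))).Adj
        (some i) (some j) ↔
      ((j : ℕ) = i + 1 ∧ 2 * (i : ℕ) + 1 ∈ T) ∨ ((i : ℕ) = j + 1 ∧ 2 * (j : ℕ) + 1 ∈ T) := by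
    intro i j
    rw [fromEdgeSet_adj, Finset.mem_coe, Finset.mem_image]
    constructor
    · rintro ⟨⟨e, he, h⟩, _⟩
      rw [gphi_path m e (hlt e he)] at h
      rcases h with ⟨h, h'⟩ | ⟨h, h'⟩
      · exact Or.inl ⟨h, h' ▸ he⟩
      · exact Or.inr ⟨h, h' ▸ he⟩
    · intro h
      refine ⟨?_, ?_⟩
      · rcases h with ⟨h, h'⟩ | ⟨h, h'⟩
        · exact ⟨_, h', (gphi_path m _ (hlt _ h') i j).mpr (Or.inl ⟨h, rfl⟩)⟩
        · exact ⟨_, h', (gphi_path m _ (hlt _ h') i j).mpr (Or.inr ⟨h, rfl⟩)⟩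
      · intro hij
        cases hij
        omega
  exact h _ T (gBC T m) (reach_B T _ h1 h2) (reach_C T _ h1 h2) (reach_BC T _ h1 h2)

theorem gadget_gen (m : ℕ) (hm : 1203 ≤ m) (a b c : Option (Fin (m + 1))) (ha : a = none)
    (hb : b = some ⟨0, by omega⟩) (hc : c = some ⟨m, by omega⟩) :
    400 * gadgetProb (m + 1) (1 / 2) (fun G => ¬ G.Reachable a b ∧ G.Reachable b c) ≤
      gadgetProb (m + 1) (1 / 2) (fun G => G.Reachable a b ∧ G.Reachable b c) *
        gadgetProb (m + 1) (1 / 2)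
          (fun G => ¬ G.Reachable a b ∧ ¬ G.Reachable b c ∧ ¬ G.Reachable c a) -
      gadgetProb (m + 1) (1 / 2) (fun G => G.Reachable a b ∧ ¬ G.Reachable b c) ^ 2 := by
  subst ha hb hc
  rw [prob_gE m _ iZ, prob_gE m _ iS, prob_gE m _ iW, prob_gE m _ iT]
  · obtain ⟨h1, h2, h3, h4, h5, h6, h7⟩ := main_inv m
    rw [h4, ← pow_two] at h7
    refine le_trans ?_ h7
    have : (1203 : ℝ) ≤ m := by exact_mod_cast hm
    exact mul_le_mul_of_nonneg_right (by linarith) h1.le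
  all_goals
    intro G T h r1 r2 r3
    simp only [r1, r3, reachable_comm (u := some (⟨m, by omega⟩ : Fin (m + 1))) (v := none), r2]
    simp only [iS, iT, iW, iZ]
    congr 1
    simp only [eq_iff_iff]
    tauto

/-- For `n = 1204` and `p = 1/2`, the connection probabilities of Bernoulli bond
percolation on `G_n` with deletion parameter `p` (with `b = v₁`, `c = vₙ`) satisfy
`400·p_{a|bc} ≤ p_{abc}·p_{a|b|c} - p_{ab|c}²`. -/
theorem gadget_1204 (a b c : Option (Fin 1204)) (ha : a = none)
    (hb : b = some ⟨0, by omega⟩) (hc : c = some ⟨1203, by omega⟩) :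
    400 * gadgetProb 1204 (1 / 2) (fun G => ¬ G.Reachable a b ∧ G.Reachable b c) ≤
      gadgetProb 1204 (1 / 2) (fun G => G.Reachable a b ∧ G.Reachable b c) *
        gadgetProb 1204 (1 / 2)
          (fun G => ¬ G.Reachable a b ∧ ¬ G.Reachable b c ∧ ¬ G.Reachable c a) -
      gadgetProb 1204 (1 / 2) (fun G => G.Reachable a b ∧ ¬ G.Reachable b c) ^ 2 := by
  exact gadget_gen 1203 le_rfl a b c ha hb hc
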